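/- arXiv:2408.15014 — 2 statements merged into one kernel-verified Lean document; each statement's English description precedes it below -/
import Mathlib

section
/- Let α and β be types and φ : α → β → Prop a relation of finite VC dimension, i.e., there is n such that no sequence of length n in α is shattered by φ. Then for all real numbers 0 ≤ r < s ≤ 1, there exists N ∈ ℕ such that no sequence ā_1,…,ā_N of finite tuples of elements of α (of arbitrary lengths k_1,…,k_N ≥ 1) is shattered by averages of elements of β for φ and r < s. -/
/-- The sequence `a 0, …, a (n-1)` is shattered by `φ`. -/
def ShatteredSeq {α β : Type*} (φ : α → β → Prop) (n : ℕ) (a : ℕ → α) : Prop :=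
  ∀ S : Set ℕ, ∃ b : β, ∀ i < n, (φ (a i) b ↔ i ∈ S)

/-- `Ave(ā)(φ(·,b))` for the `k`-tuple `ā = (aa 0, …, aa (k-1))`. -/
noncomputable def ave {α β : Type*} (φ : α → β → Prop) (k : ℕ) (aa : ℕ → α) (b : β) : ℝ :=
  ({h : ℕ | h < k ∧ φ (aa h) b}.ncard : ℝ) / k

/-- The tuples `ā_0, …, ā_{N-1}` (where `ā_i = (a i 0, …, a i (k i - 1))` has length `k i`)
are shattered by averages of elements of `β` for `φ` and `r < s`. -/
def ShatteredByAvg {α β : Type*} (φ : α → β → Prop) (r s : ℝ) (N : ℕ)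
    (k : ℕ → ℕ) (a : ℕ → ℕ → α) : Prop :=
  ∀ S : Set ℕ, ∃ t : ℕ, 1 ≤ t ∧ ∃ b : ℕ → β, ∀ i < N,
    (i ∈ S → (∑ j ∈ Finset.range t, ave φ (k i) (a i) (b j)) / t ≤ r) ∧
    (i ∉ S → s ≤ (∑ j ∈ Finset.range t, ave φ (k i) (a i) (b j)) / t)

/-- The sign `1` or `-1` encoded by a Boolean. -/
def rademacherSign (e : Bool) : ℝ := if e then 1 else -1

/-- The traces on the family `x` of the sets `{a | φ a b}`, for `b : β`. -/
noncomputable def traceFamily {α β ι : Type*} [Fintype ι] (φ : α → β → Prop) (x : ι → α) :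
    Finset (Finset ι) :=
  open Classical in Finset.univ.filter fun v => ∃ b, v = Finset.univ.filter fun i => φ (x i) b

open Classical in
theorem filter_mem_traceFamily {α β ι : Type*} [Fintype ι] (φ : α → β → Prop) (x : ι → α)
    (b : β) : (Finset.univ.filter fun i => φ (x i) b) ∈ traceFamily φ x := by
  unfold traceFamily
  exact Finset.mem_filter.2 ⟨Finset.mem_univ _, b, rfl⟩

open Classical in
theorem card_lt_of_traceFamily_shatters {α β ι : Type*} [Fintype ι] [Nonempty α]
    {φ : α → β → Prop} {n : ℕ} (hn : ∀ a : ℕ → α, ¬ ShatteredSeq φ n a) (x : ι → α)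
    {s : Finset ι} (hs : (traceFamily φ x).Shatters s) : s.card < n := by
  by_contra! hcard
  obtain ⟨t, hts, rfl⟩ := Finset.exists_subset_card_eq hcard
  replace hs := hs.mono_right hts
  let e := t.equivFin
  let a : ℕ → α := fun i => if h : i < t.card then x (e.symm ⟨i, h⟩) else Classical.arbitrary α
  refine hn a fun S => ?_
  obtain ⟨v, hv, hvt⟩ := hs (Finset.filter_subset (fun i => ∃ h : i ∈ t, (e ⟨i, h⟩ : ℕ) ∈ S) t)
  simp only [traceFamily, Finset.mem_filter, Finset.mem_univ, true_and] at hv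
  obtain ⟨b, rfl⟩ := hv
  refine ⟨b, fun i hi => ?_⟩
  have key := Finset.ext_iff.1 hvt (e.symm ⟨i, hi⟩)
  have hmem : ((e.symm ⟨i, hi⟩ : t) : ι) ∈ t := (e.symm ⟨i, hi⟩).2
  simp only [Finset.mem_inter, Finset.mem_filter, hmem, Finset.mem_univ, true_and,
    exists_true_left, Subtype.coe_eta, Equiv.apply_symm_apply] at key
  simpa only [a, hi, dif_pos] using key

theorem card_traceFamily_le {α β ι : Type*} [Fintype ι] [Nonempty α]
    {φ : α → β → Prop} {n : ℕ} (hn : ∀ a : ℕ → α, ¬ ShatteredSeq φ n a) (x : ι → α) :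
    (traceFamily φ x).card ≤ (n + 1) * (Fintype.card ι + 1) ^ n := by
  classical
  have hsub : (traceFamily φ x).shatterer ⊆
      (Finset.range n).biUnion fun d => Finset.powersetCard d (Finset.univ : Finset ι) := by
    intro s hs
    have := card_lt_of_traceFamily_shatters hn x (Finset.mem_shatterer.1 hs)
    simpa [Finset.mem_powersetCard] using this
  calc (traceFamily φ x).card ≤ (traceFamily φ x).shatterer.card :=
        Finset.card_le_card_shatterer _
    _ ≤ _ := Finset.card_le_card hsub
    _ ≤ (Finset.range n).card * (Fintype.card ι + 1) ^ n := by
        refine Finset.card_biUnion_le_card_mul _ _ _ fun d hd => ?_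
        rw [Finset.card_powersetCard, Finset.card_univ]
        calc (Fintype.card ι).choose d ≤ Fintype.card ι ^ d := Nat.choose_le_pow _ _
          _ ≤ (Fintype.card ι + 1) ^ d := Nat.pow_le_pow_left (Nat.le_succ _) _
          _ ≤ _ := Nat.pow_le_pow_right (Nat.succ_pos _) (Finset.mem_range.1 hd).le
    _ ≤ _ := by
        rw [Finset.card_range]
        exact Nat.mul_le_mul_right _ (Nat.le_succ n)

theorem sum_exp_rademacherSign_le {ι : Type*} [Fintype ι] [DecidableEq ι] (v : Finset ι)
    (c : ℝ) :
    ∑ ε : ι → Bool, Real.exp (c * ∑ i ∈ v, rademacherSign (ε i)) ≤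
      2 ^ Fintype.card ι * Real.exp (c ^ 2 / 2 * Fintype.card ι) := by
  have hprod (ε : ι → Bool) : Real.exp (c * ∑ i ∈ v, rademacherSign (ε i)) =
      ∏ i, if i ∈ v then Real.exp (c * rademacherSign (ε i)) else 1 := by
    rw [Finset.mul_sum, Real.exp_sum, Finset.prod_ite_mem, Finset.univ_inter]
  calc ∑ ε : ι → Bool, Real.exp (c * ∑ i ∈ v, rademacherSign (ε i))
      = ∏ i, ∑ e : Bool, if i ∈ v then Real.exp (c * rademacherSign e) else 1 := by
        simp_rw [hprod]
        rw [Finset.prod_univ_sum, Fintype.piFinset_univ]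
    _ ≤ ∏ _i : ι, 2 * Real.exp (c ^ 2 / 2) := by
        refine Finset.prod_le_prod (fun i _ => ?_) fun i _ => ?_
        · refine Finset.sum_nonneg fun e _ => ?_
          split_ifs <;> positivity
        · by_cases hi : i ∈ v
          · have h := Real.cosh_le_exp_half_sq c
            rw [Real.cosh_eq] at h
            simp only [hi, if_true, Fintype.sum_bool, rademacherSign, mul_one, mul_neg,
              Bool.false_eq_true, if_false]
            linarith
          · have h : 1 ≤ Real.exp (c ^ 2 / 2) := Real.one_le_exp (by positivity)
            simp only [hi, if_false, Fintype.sum_bool]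
            linarith
    _ = _ := by
        rw [Finset.prod_const, Finset.card_univ, mul_pow, ← Real.exp_nat_mul]
        ring_nf

theorem sum_rademacherSign {ι : Type*} [Fintype ι] [DecidableEq ι] (i : ι) :
    ∑ ε : ι → Bool, rademacherSign (ε i) = 0 := by
  refine Finset.sum_involution (fun ε _ => Function.update ε i (!ε i)) ?_ ?_ ?_ ?_
  · intro ε _
    cases h : ε i <;> simp [rademacherSign]
  · intro ε _ _ h
    have := congrFun h i
    simp at this
  · simp
  · simp

theorem sum_range_mul_mod (F : ℕ → ℝ) (k q : ℕ) :
    ∑ p ∈ Finset.range (k * q), F (p % k) = q * ∑ h ∈ Finset.range k, F h := by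
  induction q with
  | zero => simp
  | succ q ih =>
    rw [Nat.mul_succ, Finset.sum_range_add, ih]
    have : ∑ h ∈ Finset.range k, F ((k * q + h) % k) = ∑ h ∈ Finset.range k, F h :=
      Finset.sum_congr rfl fun h hh => by
        rw [Nat.mul_add_mod, Nat.mod_eq_of_lt (Finset.mem_range.1 hh)]
    rw [this]
    push_cast
    ring

open Classical in
theorem ave_eq_sum_mod {α β : Type*} (φ : α → β → Prop) {k P : ℕ} (hP : 0 < P) (hkP : k ∣ P)
    (a : ℕ → α) (b : β) :
    ave φ k a b = (∑ p ∈ Finset.range P, if φ (a (p % k)) b then (1 : ℝ) else 0) / P := by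
  obtain ⟨q, rfl⟩ := hkP
  have hk : (k : ℝ) ≠ 0 := by
    have := Nat.pos_of_mul_pos_right hP
    positivity
  have hq : (q : ℝ) ≠ 0 := by
    have := Nat.pos_of_mul_pos_left hP
    positivity
  rw [sum_range_mul_mod (fun h => if φ (a h) b then (1 : ℝ) else 0) k q, ave]
  have hset : {h : ℕ | h < k ∧ φ (a h) b} =
      ((Finset.range k).filter fun h => φ (a h) b : Finset ℕ) := by
    ext h
    simp
  rw [hset, Set.ncard_coe_finset, Finset.sum_boole]
  push_cast
  field_simp

/-- A pointwise substitute for Jensen's inequality for `Real.log`. -/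
theorem le_log_sub_one_add_exp_div {K : ℝ} (hK : 0 < K) (y : ℝ) :
    y ≤ Real.log K - 1 + Real.exp y / K := by
  have h := Real.add_one_le_exp (y - Real.log K)
  rw [Real.exp_sub, Real.exp_log hK] at h
  linarith

theorem exists_nat_polynomial_lt_exp (n : ℕ) {c : ℝ} (hc : 0 < c) :
    ∃ N : ℕ, ((n : ℝ) + 1) * ((N : ℝ) + 1) ^ n < Real.exp (c * N) := by
  have h := (tendsto_exp_mul_div_rpow_atTop n c hc)
  have h2 := (h.comp (Filter.tendsto_atTop_add_const_right _ (1 : ℝ)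
    tendsto_natCast_atTop_atTop)).eventually_gt_atTop (((n : ℝ) + 1) * Real.exp c)
  obtain ⟨N, hN⟩ := h2.exists
  refine ⟨N, ?_⟩
  simp only [Function.comp, Real.rpow_natCast] at hN
  rw [lt_div_iff₀ (by positivity), mul_add, Real.exp_add, mul_one] at hN
  have := Real.exp_pos c
  nlinarith

/-- A weighted mean of `{0,1}`-valued evaluations against signs is controlled by the exponential
moments of the trace families. -/
theorem sum_sign_mul_mean_le {α β ι : Type*} [Fintype ι] (φ : α → β → Prop) {P : ℕ} (hP : 0 < P)
    (x : ℕ → ι → α) (F : ι → β → ℝ)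
    (hF : ∀ i b, F i b =
      (∑ p ∈ Finset.range P, open Classical in if φ (x p i) b then (1 : ℝ) else 0) / P)
    {K : ℝ} (hK : 0 < K) (c : ℝ) (ε : ι → Bool) (b : β) :
    c * ∑ i, rademacherSign (ε i) * F i b ≤ (∑ p ∈ Finset.range P, (Real.log K - 1 +
      (∑ v ∈ traceFamily φ (x p), Real.exp (c * ∑ i ∈ v, rademacherSign (ε i))) / K)) / P := by
  classical
  have hP' : (0 : ℝ) < P := by exact_mod_cast hP
  have hswap : c * ∑ i, rademacherSign (ε i) * F i b = (∑ p ∈ Finset.range P,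
      c * ∑ i ∈ Finset.univ.filter (fun i => φ (x p i) b), rademacherSign (ε i)) / P := by
    simp_rw [hF, Finset.sum_filter]
    rw [← Finset.mul_sum, Finset.sum_comm, mul_div_assoc, Finset.sum_div]
    congr 1
    refine Finset.sum_congr rfl fun i _ => ?_
    rw [mul_div_assoc', Finset.mul_sum]
    simp
  rw [hswap]
  gcongr with p hp
  refine (le_log_sub_one_add_exp_div hK _).trans ?_
  gcongr
  exact Finset.single_le_sum
    (f := fun v => Real.exp (c * ∑ i ∈ v, rademacherSign (ε i)))
    (fun v _ => (Real.exp_pos _).le) (filter_mem_traceFamily φ (x p) b)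

/-- Massart's finite class bound for sign-weighted double means, when the second mean may depend
on the signs. -/
theorem mul_le_log_of_forall_sign_mean {α β ι : Type*} [Fintype ι] [DecidableEq ι]
    (φ : α → β → Prop) {P : ℕ} (hP : 0 < P) (x : ℕ → ι → α) (F : ι → β → ℝ)
    (hF : ∀ i b, F i b =
      (∑ p ∈ Finset.range P, open Classical in if φ (x p i) b then (1 : ℝ) else 0) / P)
    {M : ℝ} (hM : 0 < M) (hcard : ∀ p, ((traceFamily φ (x p)).card : ℝ) ≤ M)
    {c : ℝ} (hc : 0 ≤ c) (m δ : ℝ)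
    (t : (ι → Bool) → ℕ) (ht : ∀ ε, 1 ≤ t ε) (b : (ι → Bool) → ℕ → β)
    (h : ∀ ε i, δ ≤ rademacherSign (ε i) *
      ((∑ j ∈ Finset.range (t ε), F i (b ε j)) / t ε - m)) :
    c * (δ * Fintype.card ι) ≤ Real.log M + c ^ 2 / 2 * Fintype.card ι := by
  classical
  set d : ℝ := (Fintype.card ι : ℝ)
  set K : ℝ := M * Real.exp (c ^ 2 / 2 * d) with hKdef
  have hK : 0 < K := by positivity
  have hP' : (0 : ℝ) < P := by exact_mod_cast hP
  let G : (ι → Bool) → ℕ → ℝ := fun ε p => Real.log K - 1 +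
      (∑ v ∈ traceFamily φ (x p), Real.exp (c * ∑ i ∈ v, rademacherSign (ε i))) / K
  have hpoint (ε : ι → Bool) :
      c * (δ * d) + c * m * ∑ i, rademacherSign (ε i) ≤ (∑ p ∈ Finset.range P, G ε p) / P := by
    have ht' : (0 : ℝ) < t ε := by exact_mod_cast ht ε
    have h1 : δ * d ≤ ∑ i, rademacherSign (ε i) *
        ((∑ j ∈ Finset.range (t ε), F i (b ε j)) / t ε - m) := by
      have := Finset.card_nsmul_le_sum Finset.univ _ δ fun i _ => h ε i
      rwa [Finset.card_univ, nsmul_eq_mul, mul_comm] at this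
    have h2 : c * ∑ i, rademacherSign (ε i) *
        ((∑ j ∈ Finset.range (t ε), F i (b ε j)) / t ε) =
        (∑ j ∈ Finset.range (t ε), c * ∑ i, rademacherSign (ε i) * F i (b ε j)) / t ε := by
      rw [← Finset.mul_sum, Finset.sum_comm, mul_div_assoc, Finset.sum_div]
      congr 1
      refine Finset.sum_congr rfl fun i _ => ?_
      rw [mul_div_assoc', Finset.mul_sum]
    have h3 : (∑ j ∈ Finset.range (t ε), c * ∑ i, rademacherSign (ε i) * F i (b ε j)) / t ε ≤
        (∑ p ∈ Finset.range P, G ε p) / P := by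
      rw [div_le_iff₀ ht']
      have := Finset.sum_le_card_nsmul (Finset.range (t ε)) _ _ fun j _ =>
        sum_sign_mul_mean_le φ hP x F hF hK c ε (b ε j)
      rwa [Finset.card_range, nsmul_eq_mul, mul_comm] at this
    have h4 := mul_le_mul_of_nonneg_left h1 hc
    simp_rw [mul_sub, Finset.sum_sub_distrib, ← Finset.sum_mul] at h4
    rw [mul_sub, h2] at h4
    linarith
  have hG (p : ℕ) : ∑ ε : ι → Bool, G ε p ≤ 2 ^ Fintype.card ι * Real.log K := by
    have h1 : ∑ ε : ι → Bool, ∑ v ∈ traceFamily φ (x p),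
        Real.exp (c * ∑ i ∈ v, rademacherSign (ε i)) ≤ 2 ^ Fintype.card ι * K := by
      rw [Finset.sum_comm]
      calc _ ≤ (traceFamily φ (x p)).card • (2 ^ Fintype.card ι * Real.exp (c ^ 2 / 2 * d)) :=
            Finset.sum_le_card_nsmul _ _ _ fun v _ => sum_exp_rademacherSign_le v c
        _ ≤ M * (2 ^ Fintype.card ι * Real.exp (c ^ 2 / 2 * d)) := by
            rw [nsmul_eq_mul]
            gcongr
            exact hcard p
        _ = _ := by rw [hKdef]; ring
    have h2 := (div_le_iff₀ hK).2 h1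
    simp only [G, Finset.sum_add_distrib, ← Finset.sum_div, Finset.sum_const, Finset.card_univ,
      Fintype.card_fun, Fintype.card_bool, nsmul_eq_mul]
    push_cast
    linarith
  have hsum := Finset.sum_le_sum fun ε (_ : ε ∈ (Finset.univ : Finset (ι → Bool))) => hpoint ε
  have hzero : ∑ ε : ι → Bool, ∑ i, rademacherSign (ε i) = 0 := by
    rw [Finset.sum_comm]
    exact Finset.sum_eq_zero fun i _ => sum_rademacherSign i
  rw [Finset.sum_add_distrib, ← Finset.mul_sum _ _ (c * m), hzero, mul_zero, add_zero, Finset.sum_const,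
    Finset.card_univ, Fintype.card_fun, Fintype.card_bool, nsmul_eq_mul, ← Finset.sum_div,
    Finset.sum_comm, le_div_iff₀ hP'] at hsum
  have hbound := Finset.sum_le_card_nsmul (Finset.range P) _ _ fun p _ => hG p
  rw [Finset.card_range, nsmul_eq_mul] at hbound
  push_cast at hsum
  have hfin : c * (δ * d) ≤ Real.log K := by
    have hpos : (0 : ℝ) < 2 ^ Fintype.card ι * P := by positivity
    refine le_of_mul_le_mul_left ?_ hpos
    linarith
  rwa [hKdef, Real.log_mul hM.ne' (Real.exp_pos _).ne', Real.log_exp] at hfin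

theorem stmt10 {α β : Type*} (φ : α → β → Prop)
    (hVC : ∃ n : ℕ, ∀ a : ℕ → α, ¬ ShatteredSeq φ n a)
    (r s : ℝ) (hr : 0 ≤ r) (hrs : r < s) (hs : s ≤ 1) :
    ∃ N : ℕ, ∀ (k : ℕ → ℕ), (∀ i < N, 1 ≤ k i) →
      ∀ a : ℕ → ℕ → α, ¬ ShatteredByAvg φ r s N k a := by
  classical
  obtain ⟨n, hn⟩ := hVC
  set δ : ℝ := (s - r) / 2 with hδ
  have hδpos : 0 < δ := by rw [hδ]; linarith
  obtain ⟨N, hN⟩ := exists_nat_polynomial_lt_exp n (c := δ ^ 2 / 2) (by positivity)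
  refine ⟨N, fun k hk a hsh => ?_⟩
  have : Nonempty α := ⟨a 0 0⟩
  let P : ℕ := ∏ i ∈ Finset.range N, k i
  have hP : 0 < P := Finset.prod_pos fun i hi => hk i (Finset.mem_range.1 hi)
  have hM : (0 : ℝ) < ((n : ℝ) + 1) * ((N : ℝ) + 1) ^ n := by positivity
  choose t ht b hb using fun ε : Fin N → Bool =>
    hsh {i | ∃ h : i < N, ε ⟨i, h⟩ = false}
  have key := mul_le_log_of_forall_sign_mean φ hP (fun p (i : Fin N) => a i (p % k i))
    (fun i c => ave φ (k i) (a i) c)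
    (fun i c => ave_eq_sum_mod φ hP
      (Finset.dvd_prod_of_mem k (Finset.mem_range.2 i.2)) (a i) c)
    hM (fun p => by
      have := card_traceFamily_le hn fun i : Fin N => a i (p % k i)
      rw [Fintype.card_fin] at this
      exact_mod_cast this)
    hδpos.le ((r + s) / 2) δ t ht b fun ε i => by
      obtain ⟨hlow, hhigh⟩ := hb ε i i.2
      cases hε : ε i with
      | false =>
        have := hlow ⟨i.2, hε⟩
        simp only [rademacherSign, Bool.false_eq_true, if_false]
        linarith
      | true =>
        have := hhigh (by rintro ⟨_, h⟩; simp [hε] at h)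
        simp only [rademacherSign, if_true]
        linarith
  have hlog := (Real.log_lt_iff_lt_exp hM).2 hN
  rw [Fintype.card_fin] at key
  nlinarith
end

section
/- Let α and β be types and φ : α → β → Prop a stable relation, i.e., there exists L ∈ ℕ such that φ has no ladder of length L. Then for all real numbers 0 ≤ r < s ≤ 1, there exists N ∈ ℕ such that there do not exist finite tuples ā_1,…,ā_N of elements of α (ā_i of length k_i ≥ 1) and finite tuples b̄_1,…,b̄_N of elements of β (b̄_j of length m_j ≥ 1) with (1/(k_i·m_j))·Σ_{p=1}^{k_i} Σ_{q=1}^{m_j} 1_{φ(a_{i,p}, b_{j,q})} ≤ r whenever i < j and (1/(k_i·m_j))·Σ_{p=1}^{k_i} Σ_{q=1}^{m_j} 1_{φ(a_{i,p}, b_{j,q})} ≥ s whenever i ≥ j, where 1_{φ(a,b)} is 1 if φ(a,b) holds and 0 otherwise. -/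
/-- `φ` has a ladder of length `L`. -/
def HasLadder {α β : Type*} (φ : α → β → Prop) (L : ℕ) : Prop :=
  ∃ (a : ℕ → α) (c : ℕ → β), ∀ i < L, ∀ j < L, (φ (a i) (c j) ↔ j ≤ i)

/-- The product average `μ_ā ⊗ ν_b̄(φ)` of the `k`-tuple `ā = (aa 0, …, aa (k-1))` and the
`m`-tuple `b̄ = (bb 0, …, bb (m-1))`: the fraction of pairs `(p,q)` with `φ (aa p) (bb q)`. -/
noncomputable def prodAve {α β : Type*} (φ : α → β → Prop) (k m : ℕ)
    (aa : ℕ → α) (bb : ℕ → β) : ℝ :=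
  ({pq : ℕ × ℕ | pq.1 < k ∧ pq.2 < m ∧ φ (aa pq.1) (bb pq.2)}.ncard : ℝ) / (k * m)

/-- A binary tree of height `n` for `φ` with leaves in `S` and inner nodes labelled by `U`. -/
def HasTree {α β : Type*} (φ : α → β → Prop) (U : Set β) : ℕ → Set α → Prop
  | 0, S => S.Nonempty
  | n + 1, S => ∃ b ∈ U, HasTree φ U n {a ∈ S | φ a b} ∧ HasTree φ U n {a ∈ S | ¬ φ a b}

theorem HasTree.mono {α β : Type*} {φ : α → β → Prop} {U : Set β} {n : ℕ} {S S' : Set α}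
    (h : HasTree φ U n S) (hS : S ⊆ S') : HasTree φ U n S' := by
  induction n generalizing S S' with
  | zero => exact Set.Nonempty.mono hS h
  | succ n ih =>
    obtain ⟨b, hb, h1, h2⟩ := h
    exact ⟨b, hb, ih h1 fun a ha => ⟨hS ha.1, ha.2⟩, ih h2 fun a ha => ⟨hS ha.1, ha.2⟩⟩

theorem HasTree.nonempty {α β : Type*} {φ : α → β → Prop} {U : Set β} {n : ℕ} {S : Set α}
    (h : HasTree φ U n S) : S.Nonempty := by
  induction n generalizing S with
  | zero => exact h
  | succ n ih =>
    obtain ⟨b, -, h1, -⟩ := h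
    exact (ih h1).mono fun a ha => ha.1

/-- Trees are indivisible with respect to two-colourings of their inner nodes. -/
theorem HasTree.split {α β : Type*} {φ : α → β → Prop} {U : Set β} (P : β → Prop) {N : ℕ}
    {S : Set α} (h : HasTree φ U N S) (n m : ℕ) (hN : N = n + m) :
    HasTree φ {b ∈ U | P b} n S ∨ HasTree φ {b ∈ U | ¬ P b} m S := by
  induction N generalizing n m S with
  | zero =>
    obtain rfl : n = 0 := by omega
    exact Or.inl h
  | succ N ih =>
    rcases n with _ | n
    · exact Or.inl h.nonempty
    rcases m with _ | m
    · exact Or.inr h.nonempty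
    obtain ⟨b, hb, h1, h2⟩ := h
    have sub1 : {a ∈ S | φ a b} ⊆ S := fun a ha => ha.1
    have sub2 : {a ∈ S | ¬ φ a b} ⊆ S := fun a ha => ha.1
    by_cases hP : P b
    · rcases ih h1 n (m + 1) (by omega) with t1 | t1
      · rcases ih h2 n (m + 1) (by omega) with t2 | t2
        · exact Or.inl ⟨b, ⟨hb, hP⟩, t1, t2⟩
        · exact Or.inr (t2.mono sub2)
      · exact Or.inr (t1.mono sub1)
    · rcases ih h1 (n + 1) m (by omega) with t1 | t1
      · exact Or.inl (t1.mono sub1)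
      · rcases ih h2 (n + 1) m (by omega) with t2 | t2
        · exact Or.inl (t2.mono sub2)
        · exact Or.inr ⟨b, ⟨hb, hP⟩, t1, t2⟩

/-- High trees contain long ladders, with one additional element of `α` at the start. -/
theorem exists_height_forall_hasTree_ladder {α β : Type*} [Nonempty β] (φ : α → β → Prop)
    (n : ℕ) : ∃ t, ∀ (U : Set β) (S : Set α), HasTree φ U t S →
      ∃ (a : ℕ → α) (c : ℕ → β), (∀ i ≤ n, a i ∈ S) ∧ (∀ j < n, c j ∈ U) ∧
        ∀ i ≤ n, ∀ j < n, (φ (a i) (c j) ↔ j < i) := by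
  induction n with
  | zero =>
    refine ⟨0, fun U S h => ?_⟩
    obtain ⟨x, hx⟩ := h
    exact ⟨fun _ => x, fun _ => Classical.arbitrary β, by simp [hx], by simp, by simp⟩
  | succ n ih =>
    obtain ⟨t, ht⟩ := ih
    refine ⟨(t + 1) + (t + 1), fun U S h => ?_⟩
    obtain ⟨x, hx⟩ := h.nonempty
    rcases h.split (φ x) (t + 1) (t + 1) rfl with ⟨b, hb, -, h2⟩ | ⟨b, hb, h1, -⟩
    · obtain ⟨a, c, ha, hc, hac⟩ := ht _ _ h2
      refine ⟨fun i => if i ≤ n then a i else x, fun j => if j < n then c j else b, ?_, ?_, ?_⟩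
      · intro i _
        dsimp only
        split_ifs with hi
        exacts [(ha i hi).1, hx]
      · intro j _
        dsimp only
        split_ifs with hj
        exacts [(hc j hj).1, hb.1]
      · intro i hi j hj
        dsimp only
        split_ifs with h3 h4 h4
        · exact hac i h3 j h4
        · exact iff_of_false (ha i h3).2 (by omega)
        · exact iff_of_true (hc j h4).2 (by omega)
        · exact iff_of_true hb.2 (by omega)
    · obtain ⟨a, c, ha, hc, hac⟩ := ht _ _ h1
      refine ⟨fun i => if i = 0 then x else a (i - 1), fun j => if j = 0 then b else c (j - 1),
        ?_, ?_, ?_⟩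
      · intro i _
        dsimp only
        split_ifs with hi
        exacts [hx, (ha _ (by omega)).1]
      · intro j _
        dsimp only
        split_ifs with hj
        exacts [hb.1, (hc _ (by omega)).1]
      · intro i hi j hj
        dsimp only
        split_ifs with h3 h4 h4
        · exact iff_of_false hb.2 (by omega)
        · exact iff_of_false (hc _ (by omega)).2 (by omega)
        · exact iff_of_true (ha _ (by omega)).2 (by omega)
        · rw [hac _ (by omega) _ (by omega)]
          omega

theorem exists_not_hasTree {α β : Type*} [Nonempty β] {φ : α → β → Prop} {L : ℕ}
    (h : ¬ HasLadder φ L) : ∃ t, ¬ HasTree φ Set.univ t Set.univ := by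
  obtain ⟨t, ht⟩ := exists_height_forall_hasTree_ladder φ L
  refine ⟨t, fun hT => h ?_⟩
  obtain ⟨a, c, -, -, hac⟩ := ht _ _ hT
  refine ⟨fun i => a (i + 1), c, fun i hi j hj => ?_⟩
  rw [hac _ (by omega) _ hj]
  omega

theorem HasLadder.flip {α β : Type*} {φ : α → β → Prop} {L : ℕ} (h : HasLadder φ L) :
    HasLadder (flip φ) L := by
  obtain ⟨a, c, hac⟩ := h
  refine ⟨fun i => c (L - 1 - i), fun j => a (L - 1 - j), fun i hi j hj => ?_⟩
  rw [_root_.flip, hac _ (by omega) _ (by omega)]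
  omega

/-- Colourings of pairs have long end-homogeneous sequences, on which the colour of a pair
depends only on its smaller element. -/
theorem exists_endHomogeneous (C : Type*) [Finite C] (n : ℕ) :
    ∃ N, ∀ (c : ℕ → ℕ → C) (S : Finset ℕ), N ≤ S.card →
      ∃ (h : ℕ → ℕ) (x : ℕ → C), (∀ i < n, h i ∈ S) ∧ (∀ i j, i < j → j < n → h i < h j) ∧
        ∀ i j, i < j → j < n → c (h i) (h j) = x i := by
  classical
  have := Fintype.ofFinite C
  induction n with
  | zero => exact ⟨0, fun c S _ => ⟨id, fun i => c i i, by simp, by simp, by simp⟩⟩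
  | succ n ih =>
    obtain ⟨N, hN⟩ := ih
    refine ⟨Fintype.card C * N + 1, fun c S hS => ?_⟩
    have hne : S.Nonempty := Finset.card_pos.1 (by omega)
    set m := S.min' hne with hm
    have hmS : m ∈ S := S.min'_mem hne
    have : Nonempty C := ⟨c 0 0⟩
    obtain ⟨y, -, hy⟩ := Finset.exists_le_card_fiber_of_mul_le_card_of_maps_to
      (s := S.erase m) (t := (Finset.univ : Finset C)) (f := c m) (n := N)
      (fun _ _ => Finset.mem_univ _) Finset.univ_nonempty
      (by rw [Finset.card_erase_of_mem hmS, Finset.card_univ]; omega)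
    obtain ⟨h, x, hhS, hh, hx⟩ := hN c _ hy
    refine ⟨fun i => if i = 0 then m else h (i - 1), fun i => if i = 0 then y else x (i - 1),
      ?_, ?_, ?_⟩
    · intro i hi
      dsimp only
      split_ifs with h0
      · exact hmS
      · exact Finset.mem_of_mem_erase (Finset.mem_filter.1 (hhS (i - 1) (by omega))).1
    · intro i j hij hj
      dsimp only
      rw [if_neg (by omega : j ≠ 0)]
      split_ifs with h0
      · exact S.min'_lt_of_mem_erase_min' hne (Finset.mem_filter.1 (hhS (j - 1) (by omega))).1
      · exact hh _ _ (by omega) (by omega)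
    · intro i j hij hj
      dsimp only
      rw [if_neg (by omega : j ≠ 0)]
      split_ifs with h0
      · exact (Finset.mem_filter.1 (hhS (j - 1) (by omega))).2
      · exact hx _ _ (by omega) (by omega)

/-- Ramsey's theorem for pairs of natural numbers. -/
theorem exists_homogeneous (C : Type*) [Finite C] (n : ℕ) :
    ∃ N, ∀ c : ℕ → ℕ → C, ∃ (h : ℕ → ℕ) (x : C), (∀ i < n, h i < N) ∧
      (∀ i j, i < j → j < n → h i < h j) ∧ ∀ i j, i < j → j < n → c (h i) (h j) = x := by
  classical
  have := Fintype.ofFinite C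
  obtain ⟨N, hN⟩ := exists_endHomogeneous C (Fintype.card C * n)
  refine ⟨N, fun c => ?_⟩
  have : Nonempty C := ⟨c 0 0⟩
  obtain ⟨h, x, hhN, hh, hx⟩ := hN c (Finset.range N) (by simp)
  obtain ⟨y, -, hy⟩ := Finset.exists_le_card_fiber_of_mul_le_card_of_maps_to
    (s := Finset.range (Fintype.card C * n)) (t := (Finset.univ : Finset C)) (f := x) (n := n)
    (fun _ _ => Finset.mem_univ _) Finset.univ_nonempty
    (by rw [Finset.card_range, Finset.card_univ])
  obtain ⟨T, hT, hTn⟩ := Finset.exists_subset_card_eq hy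
  set e := T.orderEmbOfFin hTn
  have he (i : Fin n) : e i < Fintype.card C * n ∧ x (e i) = y := by
    simpa using hT (T.orderEmbOfFin_mem hTn i)
  refine ⟨fun i => if hi : i < n then h (e ⟨i, hi⟩) else 0, y, ?_, ?_, ?_⟩
  · intro i hi
    simp only [hi, dif_pos]
    exact Finset.mem_range.1 (hhN _ (he _).1)
  · intro i j hij hj
    simp only [hj, hij.trans hj, dif_pos]
    exact hh _ _ (e.strictMono hij) (he _).1
  · intro i j hij hj
    simp only [hj, hij.trans hj, dif_pos]
    rw [hx _ _ (e.strictMono hij) (he _).1, (he _).2]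

open Classical in
/-- `φ (x, b)` holds for all but an `ε`-fraction of the entries `x` of the finite family `X`. -/
def MostlyTrue {α β : Type*} (φ : α → β → Prop) (ε : ℝ) (X : (ℕ → α) × Finset ℕ) (b : β) : Prop :=
  (({p ∈ X.2 | ¬ φ (X.1 p) b}.card : ℕ) : ℝ) ≤ ε * X.2.card

open Classical in
/-- Every `b` has the same relation to all but an `ε`-fraction of the entries of `X`. -/
def IsGoodFamily {α β : Type*} (φ : α → β → Prop) (ε : ℝ) (X : (ℕ → α) × Finset ℕ) : Prop :=
  X.2.Nonempty ∧ ∀ b, (({p ∈ X.2 | ¬ (φ (X.1 p) b ↔ MostlyTrue φ ε X b)}.card : ℕ) : ℝ) ≤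
    ε * X.2.card

/-- The majority relation on good families. -/
def majority {α β : Type*} (φ : α → β → Prop) (ε : ℝ) (X : {X // IsGoodFamily φ ε X}) (b : β) :
    Prop :=
  MostlyTrue φ ε X.1 b

theorem IsGoodFamily.exists_forall_iff {α β : Type*} {φ : α → β → Prop} {ε : ℝ}
    {X : (ℕ → α) × Finset ℕ} (hX : IsGoodFamily φ ε X) {L : ℕ} (hL : L * ε < 1) (b : ℕ → β) :
    ∃ p ∈ X.2, ∀ j < L, (φ (X.1 p) (b j) ↔ MostlyTrue φ ε X (b j)) := by
  classical
  by_contra! h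
  have hsub : X.2 ⊆ (Finset.range L).biUnion fun j =>
      {p ∈ X.2 | ¬ (φ (X.1 p) (b j) ↔ MostlyTrue φ ε X (b j))} := by
    intro p hp
    obtain ⟨j, hj, hpj⟩ := h p hp
    simp only [Finset.mem_biUnion, Finset.mem_range, Finset.mem_filter]
    exact ⟨j, hj, hp, by tauto⟩
  have hcard : (X.2.card : ℝ) ≤ L * (ε * X.2.card) := by
    calc (X.2.card : ℝ) ≤ ((∑ j ∈ Finset.range L,
          {p ∈ X.2 | ¬ (φ (X.1 p) (b j) ↔ MostlyTrue φ ε X (b j))}.card : ℕ) : ℝ) := by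
          exact_mod_cast (Finset.card_le_card hsub).trans Finset.card_biUnion_le
      _ ≤ ∑ j ∈ Finset.range L, ε * X.2.card := by
          push_cast
          exact Finset.sum_le_sum fun j _ => hX.2 (b j)
      _ = L * (ε * X.2.card) := by simp
  have : (0 : ℝ) < X.2.card := by exact_mod_cast Finset.card_pos.2 hX.1
  nlinarith

theorem not_hasLadder_majority {α β : Type*} {φ : α → β → Prop} {ε : ℝ} {L : ℕ}
    (h : ¬ HasLadder φ L) (hL : L * ε < 1) : ¬ HasLadder (majority φ ε) L := by
  rintro ⟨X, c, hXc⟩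
  choose p _ hp using fun i => (X i).2.exists_forall_iff hL c
  exact h ⟨fun i => (X i).1.1 (p i), c, fun i hi j hj => (hp i j hj).trans (hXc i hi j hj)⟩

/-- A bound on the height of trees yields dense good subfamilies. -/
theorem exists_isGoodFamily_subset {α β : Type*} {φ : α → β → Prop} {ε : ℝ} (hε : 0 < ε)
    (hε1 : ε ≤ 1) (t : ℕ) (a : ℕ → α) (A : Finset ℕ) (hA : A.Nonempty)
    (h : ¬ HasTree φ Set.univ t (a '' A)) :
    ∃ A' ⊆ A, IsGoodFamily φ ε (a, A') ∧ ε ^ t * A.card ≤ A'.card := by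
  classical
  induction t generalizing A with
  | zero => exact absurd (hA.to_set.image a) h
  | succ t ih =>
    by_cases hg : IsGoodFamily φ ε (a, A)
    · refine ⟨A, subset_rfl, hg, ?_⟩
      exact mul_le_of_le_one_left (Nat.cast_nonneg _) (pow_le_one₀ hε.le hε1)
    have hApos : (0 : ℝ) < A.card := by exact_mod_cast Finset.card_pos.2 hA
    obtain ⟨b, hb⟩ : ∃ b, ε * A.card < ({p ∈ A | φ (a p) b}.card : ℕ) ∧
        ε * A.card < ({p ∈ A | ¬ φ (a p) b}.card : ℕ) := by
      by_contra! hcon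
      refine hg ⟨hA, fun b => ?_⟩
      by_cases hm : MostlyTrue φ ε (a, A) b
      · simp only [hm, iff_true]
        exact hm
      · have hm' := hm
        simp only [MostlyTrue, not_le] at hm'
        simp only [hm, iff_false, not_not]
        by_contra! hlt
        exact absurd (hcon b hlt) (not_le.2 hm')
    have key (B : Finset ℕ) (hBA : B ⊆ A) (hB : ε * A.card < B.card)
        (hT : ¬ HasTree φ Set.univ t (a '' B)) :
        ∃ A' ⊆ A, IsGoodFamily φ ε (a, A') ∧ ε ^ (t + 1) * A.card ≤ A'.card := by
      have hBne : B.Nonempty := by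
        rw [← Finset.card_pos]
        have : (0 : ℝ) < B.card := (mul_pos hε hApos).trans hB
        exact_mod_cast this
      obtain ⟨A', hA', hgood, hc⟩ := ih B hBne hT
      refine ⟨A', hA'.trans hBA, hgood, le_trans ?_ hc⟩
      rw [pow_succ, mul_assoc]
      exact mul_le_mul_of_nonneg_left hB.le (by positivity)
    by_cases hT : HasTree φ Set.univ t (a '' ({p ∈ A | φ (a p) b} : Finset ℕ))
    · refine key _ (Finset.filter_subset _ _) hb.2 fun hT' => h ⟨b, trivial, hT.mono ?_, hT'.mono ?_⟩
      · rintro _ ⟨p, hp, rfl⟩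
        simp only [Finset.coe_filter, Set.mem_ofPred_eq] at hp
        exact ⟨⟨p, hp.1, rfl⟩, hp.2⟩
      · rintro _ ⟨p, hp, rfl⟩
        simp only [Finset.coe_filter, Set.mem_ofPred_eq] at hp
        exact ⟨⟨p, hp.1, rfl⟩, hp.2⟩
    · exact key _ (Finset.filter_subset _ _) hb.1 hT

/-- If every nonempty set contains a good subset of density at least `d`, then up to an error `ε`
the uniform measure on `S` dominates an average of uniform measures on good sets, and the number
of these sets is independent of `S`. -/
theorem exists_pieces {d ε : ℝ} (hd : 0 < d) (hε : 0 < ε) (hε1 : ε ≤ 1) :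
    ∃ M n : ℕ, 0 < M ∧ n ≤ M ∧ (1 - ε) * M ≤ n ∧
      ∀ (Good : Finset ℕ → Prop) (S : Finset ℕ), S.Nonempty →
        (∀ A ⊆ S, A.Nonempty → ∃ A' ⊆ A, Good A' ∧ A'.Nonempty ∧ d * A.card ≤ A'.card) →
        ∃ A : ℕ → Finset ℕ, (∀ l < n, Good (A l) ∧ (A l).Nonempty ∧ A l ⊆ S) ∧
          ∀ p, ∑ l ∈ Finset.range n, (if p ∈ A l then ((M : ℝ) * (A l).card)⁻¹ else 0) ≤
            (S.card : ℝ)⁻¹ := by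
  classical
  obtain ⟨M, hM⟩ := exists_nat_ge (4 / (d * ε ^ 2) + 1 / ε)
  have hM1 : 4 / (d * ε ^ 2) ≤ M := le_trans (by simp [hε.le]) hM
  have hM2 : 1 / ε ≤ M := le_trans (le_add_of_nonneg_left (by positivity)) hM
  have hMpos : (0 : ℝ) < M := lt_of_lt_of_le (by positivity) hM2
  have hεM : 1 ≤ M * ε := by rwa [div_le_iff₀ hε] at hM2
  have hdM : 4 ≤ M * (d * ε ^ 2) := by rwa [div_le_iff₀ (by positivity)] at hM1
  have hnn : 0 ≤ (1 - ε) * M := mul_nonneg (by linarith) hMpos.le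
  have hfl := Nat.floor_le hnn
  refine ⟨M, ⌊(1 - ε) * M⌋₊ + 1, by exact_mod_cast hMpos, ?_, ?_, ?_⟩
  · have : ((⌊(1 - ε) * M⌋₊ + 1 : ℕ) : ℝ) ≤ M := by
      push_cast
      linarith
    exact_mod_cast this
  · push_cast
    exact (Nat.lt_floor_add_one _).le
  intro Good S hS hgood
  set k : ℝ := (S.card : ℝ) with hk
  have hkpos : 0 < k := by rw [hk]; exact_mod_cast Finset.card_pos.2 hS
  suffices H : ∀ n : ℕ, n ≤ ⌊(1 - ε) * M⌋₊ + 1 →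
      ∃ A : ℕ → Finset ℕ, (∀ l < n, Good (A l) ∧ (A l).Nonempty ∧ A l ⊆ S) ∧
        ∀ p, ∑ l ∈ Finset.range n, (if p ∈ A l then ((M : ℝ) * (A l).card)⁻¹ else 0) ≤ k⁻¹ from
    H _ le_rfl
  intro n
  induction n with
  | zero => exact fun _ => ⟨fun _ => ∅, by simp, by simp [hkpos.le]⟩
  | succ n ih =>
    intro hn
    obtain ⟨A, hA, hsum⟩ := ih (by omega)
    have hnM : (n : ℝ) ≤ (1 - ε) * M := le_trans (by exact_mod_cast (by omega)) hfl
    set w : ℕ → ℝ := fun p =>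
      ∑ l ∈ Finset.range n, (if p ∈ A l then ((M : ℝ) * (A l).card)⁻¹ else 0) with hw
    have hw0 (p : ℕ) : 0 ≤ w p := Finset.sum_nonneg fun l _ => by split_ifs <;> positivity
    have hwtot : ∑ p ∈ S, w p = n / M := by
      rw [hw, Finset.sum_comm]
      calc _ = ∑ l ∈ Finset.range n, (M : ℝ)⁻¹ := by
            refine Finset.sum_congr rfl fun l hl => ?_
            obtain ⟨-, hne, hsub⟩ := hA l (Finset.mem_range.1 hl)
            have : ((A l).card : ℝ) ≠ 0 := by exact_mod_cast (Finset.card_pos.2 hne).ne'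
            rw [Finset.sum_ite_mem, Finset.inter_eq_right.2 hsub, Finset.sum_const, nsmul_eq_mul]
            field_simp
        _ = n / M := by simp [div_eq_mul_inv]
    set R : Finset ℕ := {p ∈ S | ε / (2 * k) ≤ k⁻¹ - w p} with hR
    have hRcard : ε / 2 * k ≤ R.card := by
      have h1 : ε ≤ ∑ p ∈ S, (k⁻¹ - w p) := by
        rw [Finset.sum_sub_distrib, hwtot, Finset.sum_const, nsmul_eq_mul, ← hk,
          mul_inv_cancel₀ hkpos.ne']
        have : (n : ℝ) / M ≤ 1 - ε := by rwa [div_le_iff₀ hMpos]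
        linarith
      have h2 : ∑ p ∈ S, (k⁻¹ - w p) ≤
          ∑ p ∈ S, ((if p ∈ R then k⁻¹ else 0) + ε / (2 * k)) := by
        refine Finset.sum_le_sum fun p hp => ?_
        have := hw0 p
        have : 0 ≤ ε / (2 * k) := by positivity
        split_ifs with hpR
        · linarith
        · have : ¬ ε / (2 * k) ≤ k⁻¹ - w p := fun hle => hpR (Finset.mem_filter.2 ⟨hp, hle⟩)
          linarith
      rw [Finset.sum_add_distrib, Finset.sum_ite_mem,
        Finset.inter_eq_right.2 (Finset.filter_subset _ _), Finset.sum_const, Finset.sum_const,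
        nsmul_eq_mul, nsmul_eq_mul, ← hk] at h2
      have h3 : k * (ε / (2 * k)) = ε / 2 := by field_simp
      have h4 : ε / 2 ≤ R.card * k⁻¹ := by linarith
      rwa [← div_eq_mul_inv, le_div_iff₀ hkpos] at h4
    have hRne : R.Nonempty := by
      rw [← Finset.card_pos]
      have : (0 : ℝ) < R.card := lt_of_lt_of_le (by positivity) hRcard
      exact_mod_cast this
    obtain ⟨B, hBR, hBgood, hBne, hBcard⟩ := hgood R (Finset.filter_subset _ _) hRne
    have hBpos : (0 : ℝ) < B.card := by exact_mod_cast Finset.card_pos.2 hBne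
    have hBinv : ((M : ℝ) * B.card)⁻¹ ≤ ε / (2 * k) := by
      rw [inv_le_comm₀ (by positivity) (by positivity), inv_div, div_le_iff₀ hε]
      have h1 : d * (ε / 2 * k) ≤ B.card := (mul_le_mul_of_nonneg_left hRcard hd.le).trans hBcard
      have h2 := mul_le_mul_of_nonneg_left h1 (mul_nonneg hMpos.le hε.le)
      nlinarith
    refine ⟨fun l => if l < n then A l else B, ?_, ?_⟩
    · intro l _
      dsimp only
      split_ifs with hl
      · exact hA l hl
      · exact ⟨hBgood, hBne, hBR.trans (Finset.filter_subset _ _)⟩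
    · intro p
      rw [Finset.sum_range_succ]
      have : ∑ l ∈ Finset.range n, (if p ∈ (if l < n then A l else B) then
          ((M : ℝ) * (if l < n then A l else B).card)⁻¹ else 0) = w p :=
        Finset.sum_congr rfl fun l hl => by simp only [if_pos (Finset.mem_range.1 hl)]
      rw [this]
      simp only [lt_irrefl, if_false]
      split_ifs with hpB
      · have := (Finset.mem_filter.1 (hBR hpB)).2
        linarith
      · rw [add_zero]
        exact hsum p

/-- The average of `f` over `A`. -/
noncomputable def mean (A : Finset ℕ) (f : ℕ → ℝ) : ℝ := (A.card : ℝ)⁻¹ * ∑ p ∈ A, f p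

open Classical in
/-- The truth value of `P` as a real number. -/
noncomputable def truthValue (P : Prop) : ℝ := if P then 1 else 0

theorem truthValue_nonneg (P : Prop) : 0 ≤ truthValue P := by
  unfold truthValue
  split_ifs <;> norm_num

theorem truthValue_le_one (P : Prop) : truthValue P ≤ 1 := by
  unfold truthValue
  split_ifs <;> norm_num

theorem mean_nonneg {A : Finset ℕ} {f : ℕ → ℝ} (hf : ∀ p, 0 ≤ f p) : 0 ≤ mean A f :=
  mul_nonneg (by positivity) (Finset.sum_nonneg fun p _ => hf p)

theorem mean_comm (A B : Finset ℕ) (f : ℕ → ℕ → ℝ) :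
    mean A (fun p => mean B (f p)) = mean B fun q => mean A fun p => f p q := by
  simp only [mean, ← Finset.mul_sum]
  rw [Finset.sum_comm]
  ring

theorem mean_one_sub {A : Finset ℕ} (hA : A.Nonempty) (f : ℕ → ℝ) :
    mean A (fun p => 1 - f p) = 1 - mean A f := by
  have : (A.card : ℝ) ≠ 0 := by exact_mod_cast (Finset.card_pos.2 hA).ne'
  simp only [mean, Finset.sum_sub_distrib, Finset.sum_const, nsmul_eq_mul, mul_one, mul_sub]
  rw [inv_mul_cancel₀ this]

theorem abs_mean_sub_mean_le {A : Finset ℕ} (hA : A.Nonempty) {f g : ℕ → ℝ} {ε : ℝ}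
    (h : ∀ p, |f p - g p| ≤ ε) : |mean A f - mean A g| ≤ ε := by
  have hpos : (0 : ℝ) < A.card := by exact_mod_cast Finset.card_pos.2 hA
  rw [mean, mean, ← mul_sub, ← Finset.sum_sub_distrib, abs_mul, abs_of_pos (inv_pos.2 hpos),
    inv_mul_le_iff₀ hpos]
  refine (Finset.abs_sum_le_sum_abs _ _).trans ((Finset.sum_le_sum fun p _ => h p).trans ?_)
  simp

open Classical in
theorem mean_truthValue (A : Finset ℕ) (P : ℕ → Prop) :
    mean A (fun p => truthValue (P p)) = (({p ∈ A | P p}.card : ℕ) : ℝ) / A.card := by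
  simp only [mean, truthValue, Finset.sum_boole]
  ring

open Classical in
theorem abs_mean_truthValue_sub_le {A : Finset ℕ} (hA : A.Nonempty) {P : ℕ → Prop} {Q : Prop}
    {ε : ℝ} (h : (({p ∈ A | ¬ (P p ↔ Q)}.card : ℕ) : ℝ) ≤ ε * A.card) :
    |mean A (fun p => truthValue (P p)) - truthValue Q| ≤ ε := by
  have hpos : (0 : ℝ) < A.card := by exact_mod_cast Finset.card_pos.2 hA
  have hε : mean A (fun p => truthValue (¬ (P p ↔ Q))) ≤ ε := by
    rw [mean_truthValue, div_le_iff₀ hpos]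
    refine le_of_eq_of_le ?_ h
    congr!
  have h0 : 0 ≤ mean A (fun p => truthValue (¬ (P p ↔ Q))) :=
    mean_nonneg fun _ => truthValue_nonneg _
  by_cases hQ : Q
  · have : (fun p => truthValue (¬ (P p ↔ Q))) = fun p => 1 - truthValue (P p) := by
      funext p
      by_cases hp : P p <;> simp [truthValue, hp, hQ]
    rw [this, mean_one_sub hA] at hε h0
    rw [abs_le, truthValue, if_pos hQ]
    constructor <;> linarith
  · have : (fun p => truthValue (¬ (P p ↔ Q))) = fun p => truthValue (P p) := by
      funext p
      by_cases hp : P p <;> simp [truthValue, hp, hQ]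
    rw [this] at hε h0
    rw [abs_le, truthValue, if_neg hQ]
    constructor <;> linarith

/-- The density of `φ` between a good family and a family which is good for the majority relation
is close to `0` or to `1`. -/
theorem abs_density_sub_truthValue_le {α β : Type*} {φ : α → β → Prop} {ε : ℝ}
    {X : (ℕ → α) × Finset ℕ} (hX : IsGoodFamily φ ε X) {Y : (ℕ → β) × Finset ℕ}
    (hY : IsGoodFamily (flip (majority φ ε)) ε Y) :
    |mean X.2 (fun p => mean Y.2 fun q => truthValue (φ (X.1 p) (Y.1 q))) -
      truthValue (MostlyTrue (flip (majority φ ε)) ε Y ⟨X, hX⟩)| ≤ 2 * ε := by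
  rw [mean_comm]
  have h1 := abs_mean_sub_mean_le hY.1 fun q =>
    abs_mean_truthValue_sub_le hX.1 (hX.2 (Y.1 q))
  have h2 := abs_mean_truthValue_sub_le hY.1 (hY.2 ⟨X, hX⟩)
  have h3 := abs_add_le _ _ |>.trans (add_le_add h1 h2)
  refine le_trans (le_of_eq ?_) (h3.trans_eq (two_mul ε).symm)
  congr 1
  simp only [flip, majority]
  ring

/-- The uniform measure on `S` dominates `M⁻¹` times the sum of the uniform measures on the
sets `A l`, `l < n`. -/
def IsMinorized (S : Finset ℕ) (M n : ℕ) (A : ℕ → Finset ℕ) : Prop :=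
  (∀ l < n, A l ⊆ S) ∧
    ∀ p, ∑ l ∈ Finset.range n, (if p ∈ A l then ((M : ℝ) * (A l).card)⁻¹ else 0) ≤ (S.card : ℝ)⁻¹

theorem IsMinorized.sum_mean_le {S : Finset ℕ} {M n : ℕ} {A : ℕ → Finset ℕ}
    (h : IsMinorized S M n A) {g : ℕ → ℝ} (hg : ∀ p, 0 ≤ g p) :
    (M : ℝ)⁻¹ * ∑ l ∈ Finset.range n, mean (A l) g ≤ mean S g := by
  calc (M : ℝ)⁻¹ * ∑ l ∈ Finset.range n, mean (A l) g
      = ∑ p ∈ S, (∑ l ∈ Finset.range n,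
          (if p ∈ A l then ((M : ℝ) * (A l).card)⁻¹ else 0)) * g p := by
        simp only [Finset.sum_mul]
        rw [Finset.sum_comm, Finset.mul_sum]
        refine Finset.sum_congr rfl fun l hl => ?_
        simp only [ite_mul, zero_mul]
        rw [Finset.sum_ite_mem, Finset.inter_eq_right.2 (h.1 l (Finset.mem_range.1 hl)),
          ← Finset.mul_sum, mean, mul_inv, mul_assoc]
    _ ≤ ∑ p ∈ S, (S.card : ℝ)⁻¹ * g p :=
        Finset.sum_le_sum fun p _ => mul_le_mul_of_nonneg_right (h.2 p) (hg p)
    _ = mean S g := by rw [mean, Finset.mul_sum]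

theorem IsMinorized.sum_sum_mean_le {S S' : Finset ℕ} {M n M' n' : ℕ} {A B : ℕ → Finset ℕ}
    (hA : IsMinorized S M n A) (hB : IsMinorized S' M' n' B) {g : ℕ → ℕ → ℝ}
    (hg : ∀ p q, 0 ≤ g p q) :
    (M : ℝ)⁻¹ * ∑ u ∈ Finset.range n, (M' : ℝ)⁻¹ * ∑ v ∈ Finset.range n',
      mean (A u) (fun p => mean (B v) (g p)) ≤ mean S fun p => mean S' (g p) := by
  calc _ ≤ (M : ℝ)⁻¹ * ∑ u ∈ Finset.range n, mean (A u) (fun p => mean S' (g p)) := by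
        refine mul_le_mul_of_nonneg_left (Finset.sum_le_sum fun u _ => ?_) (by positivity)
        simp only [mean_comm (A u)]
        exact hB.sum_mean_le fun q => mean_nonneg fun p => hg p q
    _ ≤ _ := hA.sum_mean_le fun p => mean_nonneg fun q => hg p q

theorem IsMinorized.mean_bounds {S S' : Finset ℕ} {M n M' n' : ℕ} {A B : ℕ → Finset ℕ} {ε : ℝ}
    (hM : 0 < M) (hM' : 0 < M') (hn : n ≤ M) (hn' : n' ≤ M') (hε : 0 ≤ ε)
    (hnM : (1 - ε) * M ≤ n) (hnM' : (1 - ε) * M' ≤ n')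
    (hS : S.Nonempty) (hS' : S'.Nonempty)
    (hA : IsMinorized S M n A) (hB : IsMinorized S' M' n' B)
    (hAne : ∀ u < n, (A u).Nonempty) (hBne : ∀ v < n', (B v).Nonempty)
    (P T : ℕ → ℕ → Prop)
    (hT : ∀ u < n, ∀ v < n',
      |mean (A u) (fun p => mean (B v) fun q => truthValue (P p q)) - truthValue (T u v)| ≤ 2 * ε) :
    (M : ℝ)⁻¹ * ∑ u ∈ Finset.range n, (M' : ℝ)⁻¹ * ∑ v ∈ Finset.range n', truthValue (T u v) ≤
        mean S (fun p => mean S' fun q => truthValue (P p q)) + 2 * ε ∧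
      mean S (fun p => mean S' fun q => truthValue (P p q)) ≤
        (M : ℝ)⁻¹ * ∑ u ∈ Finset.range n, (M' : ℝ)⁻¹ * ∑ v ∈ Finset.range n', truthValue (T u v) +
          4 * ε := by
  have hMr : (0 : ℝ) < M := by exact_mod_cast hM
  have hMr' : (0 : ℝ) < M' := by exact_mod_cast hM'
  set x : ℝ := (M : ℝ)⁻¹ * n with hx
  set y : ℝ := (M' : ℝ)⁻¹ * n' with hy
  have hx0 : 0 ≤ x := by positivity
  have hy0 : 0 ≤ y := by positivity
  have hx1 : x ≤ 1 := by
    rw [hx, inv_mul_le_iff₀ hMr, mul_one]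
    exact_mod_cast hn
  have hy1 : y ≤ 1 := by
    rw [hy, inv_mul_le_iff₀ hMr', mul_one]
    exact_mod_cast hn'
  have hx2 : 1 - ε ≤ x := by
    rw [hx, le_inv_mul_iff₀ hMr]
    linarith
  have hy2 : 1 - ε ≤ y := by
    rw [hy, le_inv_mul_iff₀ hMr']
    linarith
  have hconst (e : ℝ) : (M : ℝ)⁻¹ * ∑ u ∈ Finset.range n, (M' : ℝ)⁻¹ * ∑ v ∈ Finset.range n', e =
      x * y * e := by
    simp only [Finset.sum_const, Finset.card_range, nsmul_eq_mul, hx, hy]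
    ring
  have hmono {F G : ℕ → ℕ → ℝ} (h : ∀ u < n, ∀ v < n', F u v ≤ G u v) :
      (M : ℝ)⁻¹ * ∑ u ∈ Finset.range n, (M' : ℝ)⁻¹ * ∑ v ∈ Finset.range n', F u v ≤
        (M : ℝ)⁻¹ * ∑ u ∈ Finset.range n, (M' : ℝ)⁻¹ * ∑ v ∈ Finset.range n', G u v := by
    refine mul_le_mul_of_nonneg_left (Finset.sum_le_sum fun u hu => ?_) (by positivity)
    refine mul_le_mul_of_nonneg_left (Finset.sum_le_sum fun v hv => ?_) (by positivity)
    exact h u (Finset.mem_range.1 hu) v (Finset.mem_range.1 hv)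
  have hadd (F G : ℕ → ℕ → ℝ) :
      (M : ℝ)⁻¹ * ∑ u ∈ Finset.range n, (M' : ℝ)⁻¹ * ∑ v ∈ Finset.range n', (F u v - G u v) =
        (M : ℝ)⁻¹ * ∑ u ∈ Finset.range n, (M' : ℝ)⁻¹ * ∑ v ∈ Finset.range n', F u v -
        (M : ℝ)⁻¹ * ∑ u ∈ Finset.range n, (M' : ℝ)⁻¹ * ∑ v ∈ Finset.range n', G u v := by
    simp only [Finset.sum_sub_distrib, mul_sub]
  have hxy : x * y ≤ 1 := mul_le_one₀ hx1 hy0 hy1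
  have hxy' : 1 - 2 * ε ≤ x * y := by nlinarith
  have hxyε : x * y * (2 * ε) ≤ 2 * ε := mul_le_of_le_one_left (by linarith) hxy
  constructor
  · have h1 := hA.sum_sum_mean_le hB (g := fun p q => truthValue (P p q))
      fun p q => truthValue_nonneg _
    have h2 := hmono (F := fun u v => truthValue (T u v) - 2 * ε) fun u hu v hv => by
      have := (abs_le.1 (hT u hu v hv)).1
      show truthValue (T u v) - 2 * ε ≤
        mean (A u) (fun p => mean (B v) fun q => truthValue (P p q))
      linarith
    rw [hadd, hconst] at h2
    linarith
  · have h1 := hA.sum_sum_mean_le hB (g := fun p q => 1 - truthValue (P p q))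
      fun p q => sub_nonneg.2 (truthValue_le_one _)
    have h2 := hmono (F := fun u v => (1 - 2 * ε) - truthValue (T u v))
      (G := fun u v => mean (A u) fun p => mean (B v) fun q => 1 - truthValue (P p q))
      fun u hu v hv => by
        have := (abs_le.1 (hT u hu v hv)).2
        simp only [mean_one_sub (hBne v hv), mean_one_sub (hAne u hu)]
        linarith
    simp only [mean_one_sub hS', mean_one_sub hS] at h1
    rw [hadd, hconst] at h2
    linarith

theorem prodAve_eq_mean {α β : Type*} (φ : α → β → Prop) (k m : ℕ) (a : ℕ → α) (b : ℕ → β) :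
    prodAve φ k m a b = mean (Finset.range k) fun p => mean (Finset.range m) fun q =>
      truthValue (φ (a p) (b q)) := by
  classical
  have hset : {pq : ℕ × ℕ | pq.1 < k ∧ pq.2 < m ∧ φ (a pq.1) (b pq.2)} =
      (((Finset.range k ×ˢ Finset.range m).filter fun pq => φ (a pq.1) (b pq.2) :
        Finset (ℕ × ℕ)) : Set (ℕ × ℕ)) := by
    ext pq
    simp [and_assoc]
  have hsum : ∑ p ∈ Finset.range k, ∑ q ∈ Finset.range m, truthValue (φ (a p) (b q)) =
      (((Finset.range k ×ˢ Finset.range m).filter fun pq => φ (a pq.1) (b pq.2)).card : ℝ) := by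
    rw [← Finset.sum_product', ← Finset.sum_boole]
    exact Finset.sum_congr rfl fun _ _ => by simp [truthValue]
  rw [prodAve, hset, Set.ncard_coe_finset, ← hsum]
  simp only [mean, ← Finset.mul_sum, Finset.card_range]
  rw [div_eq_mul_inv, mul_inv]
  ring

/-- The good pieces of `exists_pieces` for tuples, in a relation without long ladders. -/
theorem exists_good_pieces {α β : Type*} [Nonempty β] {φ : α → β → Prop} {L : ℕ}
    (h : ¬ HasLadder φ L) {ε : ℝ} (hε : 0 < ε) (hε1 : ε ≤ 1) :
    ∃ M n : ℕ, 0 < M ∧ n ≤ M ∧ (1 - ε) * M ≤ n ∧ ∀ (a : ℕ → α) (S : Finset ℕ), S.Nonempty →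
      ∃ A : ℕ → Finset ℕ, (∀ l < n, IsGoodFamily φ ε (a, A l)) ∧ IsMinorized S M n A := by
  obtain ⟨t, ht⟩ := exists_not_hasTree h
  obtain ⟨M, n, hM, hn, hnM, H⟩ := exists_pieces (pow_pos hε t) hε hε1
  refine ⟨M, n, hM, hn, hnM, fun a S hS => ?_⟩
  obtain ⟨A, hA, hsum⟩ := H (fun A => IsGoodFamily φ ε (a, A)) S hS fun A _ hA => by
    obtain ⟨A', hsub, hgood, hcard⟩ := exists_isGoodFamily_subset hε hε1 t a A hA
      fun hT => ht (hT.mono (Set.subset_univ _))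
    exact ⟨A', hsub, hgood, hgood.1, hcard⟩
  exact ⟨A, fun l hl => (hA l hl).1, fun l hl => (hA l hl).2.2, hsum⟩

/-- A ladder in the majority relation between good families comes from a ladder of points. -/
theorem hasLadder_of_good_ladder {α β : Type*} [Nonempty β] {φ : α → β → Prop} {ε : ℝ} {L : ℕ}
    (hL : L * ε < 1) (X : ℕ → {X // IsGoodFamily φ ε X}) (Y : ℕ → (ℕ → β) × Finset ℕ)
    (hY : ∀ j < L, IsGoodFamily (flip (majority φ ε)) ε (Y j))
    (hXY : ∀ i < L, ∀ j < L, (MostlyTrue (flip (majority φ ε)) ε (Y j) (X i) ↔ j ≤ i)) :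
    HasLadder φ L := by
  have hc (j : ℕ) : ∃ y : β, j < L → ∀ i < L, (majority φ ε (X i) y ↔ j ≤ i) := by
    by_cases hj : j < L
    · obtain ⟨q, -, hq⟩ := (hY j hj).exists_forall_iff hL X
      exact ⟨(Y j).1 q, fun _ i hi => (hq i hi).trans (hXY i hi j hj)⟩
    · exact ⟨Classical.arbitrary β, fun h => absurd h hj⟩
  choose c hc using hc
  choose p _ hp using fun i => (X i).2.exists_forall_iff hL c
  exact ⟨fun i => (X i).1.1 (p i), c, fun i hi j hj => (hp i j hj).trans (hc j hj i hi)⟩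

theorem stmt13 {α β : Type*} (φ : α → β → Prop)
    (hstable : ∃ L : ℕ, ¬ HasLadder φ L)
    (r s : ℝ) (hr : 0 ≤ r) (hrs : r < s) (hs : s ≤ 1) :
    ∃ N : ℕ, ¬ ∃ (k m : ℕ → ℕ) (a : ℕ → ℕ → α) (b : ℕ → ℕ → β),
      (∀ i < N, 1 ≤ k i) ∧ (∀ j < N, 1 ≤ m j) ∧
      (∀ i < N, ∀ j < N,
        (i < j → prodAve φ (k i) (m j) (a i) (b j) ≤ r) ∧
        (j ≤ i → s ≤ prodAve φ (k i) (m j) (a i) (b j))) := by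
  classical
  obtain ⟨L, hL⟩ := hstable
  by_cases hne : Nonempty β
  swap
  · exact ⟨0, fun ⟨_, _, _, b, _⟩ => hne ⟨b 0 0⟩⟩
  obtain ⟨ε, hε, hε1, hgap, hLε⟩ : ∃ ε : ℝ, 0 < ε ∧ ε ≤ 1 ∧ 6 * ε < s - r ∧ L * ε < 1 := by
    have hL0 : (0 : ℝ) ≤ L := Nat.cast_nonneg L
    refine ⟨(s - r) / (7 * (L + 1)), div_pos (by linarith) (by positivity), ?_, ?_, ?_⟩
    · rw [div_le_one (by positivity)]
      linarith
    · rw [← mul_div_assoc, div_lt_iff₀ (by positivity)]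
      nlinarith
    · rw [← mul_div_assoc, div_lt_one (by positivity)]
      nlinarith
  obtain ⟨M, n, hM, hn, hnM, hpieces⟩ := exists_good_pieces hL hε hε1
  by_cases hG : Nonempty {X // IsGoodFamily φ ε X}
  swap
  · refine ⟨1, fun ⟨k, m, a, b, hk, _, _⟩ => hG ?_⟩
    obtain ⟨t, ht⟩ := exists_not_hasTree hL
    obtain ⟨A, -, hA, -⟩ := exists_isGoodFamily_subset hε hε1 t (a 0) {0}
      (Finset.singleton_nonempty 0) fun hT => ht (hT.mono (Set.subset_univ _))
    exact ⟨⟨_, hA⟩⟩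
  obtain ⟨M', n', hM', hn', hnM', hpieces'⟩ := exists_good_pieces
    (fun h => not_hasLadder_majority hL hLε h.flip : ¬ HasLadder (flip (majority φ ε)) L) hε hε1
  obtain ⟨N, hN⟩ := exists_homogeneous (Fin n → Fin n' → Prop × Prop) (2 * L + 2)
  refine ⟨N, ?_⟩
  rintro ⟨k, m, a, b, hk, hm, hab⟩
  have hrange {l : ℕ} (hl : 1 ≤ l) : (Finset.range l).Nonempty :=
    Finset.nonempty_range_iff.2 (by omega)
  have hA (i : ℕ) : ∃ A : ℕ → Finset ℕ, i < N → (∀ l < n, IsGoodFamily φ ε (a i, A l)) ∧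
      IsMinorized (Finset.range (k i)) M n A := by
    by_cases hi : i < N
    · obtain ⟨A, hA⟩ := hpieces (a i) _ (hrange (hk i hi))
      exact ⟨A, fun _ => hA⟩
    · exact ⟨fun _ => ∅, fun h => absurd h hi⟩
  have hB (j : ℕ) : ∃ B : ℕ → Finset ℕ, j < N →
      (∀ l < n', IsGoodFamily (flip (majority φ ε)) ε (b j, B l)) ∧
      IsMinorized (Finset.range (m j)) M' n' B := by
    by_cases hj : j < N
    · obtain ⟨B, hB⟩ := hpieces' (b j) _ (hrange (hm j hj))
      exact ⟨B, fun _ => hB⟩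
    · exact ⟨fun _ => ∅, fun h => absurd h hj⟩
  choose A hA using hA
  choose B hB using hB
  set T : ℕ → ℕ → ℕ → ℕ → Prop := fun i j u v => ∃ h : IsGoodFamily φ ε (a i, A i u),
    MostlyTrue (flip (majority φ ε)) ε (b j, B j v) ⟨_, h⟩ with hT
  have hbounds (i j : ℕ) (hi : i < N) (hj : j < N) :=
    IsMinorized.mean_bounds hM hM' hn hn' hε.le hnM hnM' (hrange (hk i hi)) (hrange (hm j hj))
      (hA i hi).2 (hB j hj).2 (fun u hu => ((hA i hi).1 u hu).1) (fun v hv => ((hB j hj).1 v hv).1)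
      (fun p q => φ (a i p) (b j q)) (T i j) (fun u hu v hv => by
        have hX := (hA i hi).1 u hu
        have := abs_density_sub_truthValue_le hX ((hB j hj).1 v hv)
        simpa only [hT, hX, exists_true_left] using this)
  obtain ⟨h, x, hhN, hh, hx⟩ := hN fun i j u v => (T i j u v, T j i u v)
  have h01 := hh 0 1 one_pos (by omega)
  have h0N := hhN 0 (by omega)
  have h1N := hhN 1 (by omega)
  obtain ⟨u, hu, v, hv, hT1, hT0⟩ :
      ∃ u < n, ∃ v < n', T (h 1) (h 0) u v ∧ ¬ T (h 0) (h 1) u v := by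
    by_contra! hcon
    have hle : (M : ℝ)⁻¹ * ∑ u ∈ Finset.range n, (M' : ℝ)⁻¹ * ∑ v ∈ Finset.range n',
          truthValue (T (h 1) (h 0) u v) ≤
        (M : ℝ)⁻¹ * ∑ u ∈ Finset.range n, (M' : ℝ)⁻¹ * ∑ v ∈ Finset.range n',
          truthValue (T (h 0) (h 1) u v) := by
      refine mul_le_mul_of_nonneg_left (Finset.sum_le_sum fun u hu => ?_) (by positivity)
      refine mul_le_mul_of_nonneg_left (Finset.sum_le_sum fun v hv => ?_) (by positivity)
      by_cases h1 : T (h 1) (h 0) u v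
      · have h2 := hcon u (Finset.mem_range.1 hu) v (Finset.mem_range.1 hv) h1
        rw [truthValue, truthValue, if_pos h1, if_pos h2]
      · rw [truthValue, if_neg h1]
        exact truthValue_nonneg _
    have hlow := (hbounds (h 0) (h 1) h0N h1N).1
    have hupp := (hbounds (h 1) (h 0) h1N h0N).2
    have hr' := (hab (h 0) h0N (h 1) h1N).1 h01
    have hs' := (hab (h 1) h1N (h 0) h0N).2 h01.le
    rw [prodAve_eq_mean] at hr' hs'
    linarith
  have hx' (i j : ℕ) (hij : i < j) (hj : j < 2 * L + 2) :
      ¬ T (h i) (h j) u v ∧ T (h j) (h i) u v := by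
    have h1 := congrFun (congrFun ((hx i j hij hj).trans (hx 0 1 one_pos (by omega)).symm)
      ⟨u, hu⟩) ⟨v, hv⟩
    simp only [Prod.mk.injEq] at h1
    rw [h1.1, h1.2]
    exact ⟨hT0, hT1⟩
  have hX (i : ℕ) : ∃ X : {X // IsGoodFamily φ ε X}, i < L →
      X.1 = (a (h (2 * i + 1)), A (h (2 * i + 1)) u) := by
    by_cases hi : i < L
    · exact ⟨⟨_, (hA _ (hhN (2 * i + 1) (by omega))).1 u hu⟩, fun _ => rfl⟩
    · exact ⟨Classical.arbitrary _, fun h => absurd h hi⟩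
  choose X hX using hX
  refine hL (hasLadder_of_good_ladder hLε X (fun j => (b (h (2 * j)), B (h (2 * j)) v))
    (fun j hj => (hB _ (hhN (2 * j) (by omega))).1 v hv) fun i hi j hj => ?_)
  have hTX : MostlyTrue (flip (majority φ ε)) ε (b (h (2 * j)), B (h (2 * j)) v) (X i) ↔
      T (h (2 * i + 1)) (h (2 * j)) u v := by
    have hgood := (hA _ (hhN (2 * i + 1) (by omega))).1 u hu
    rw [show X i = ⟨_, hgood⟩ from Subtype.ext (hX i hi)]
    simp only [hT, hgood, exists_true_left]
  rw [hTX]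
  rcases Nat.lt_or_ge i j with hij | hij
  · exact iff_of_false (hx' _ _ (by omega) (by omega)).1 (by omega)
  · exact iff_of_true (hx' _ _ (by omega) (by omega)).2 hij
end
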